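/- arXiv:1203.2101 — 3 statements merged into one kernel-verified Lean document; each statement's English description precedes it below -/
import Mathlib

section
/- Let $V$ be a real vector space endowed with an inner product, with norm $|X| = \sqrt{X\cdot X}$. Then for any real $q \ge 0$ and any $X, Y \in V$, one has $\left||X|^q X - |Y|^q Y\right| \le (q+1)\left(|X|^q + |Y|^q\right)|X - Y|$. -/
/-- A mean-value type bound for real powers, valid for all exponents `q ≥ 0`. -/
theorem Real.rpow_sub_rpow_mul_le {a b q : ℝ} (hq : 0 ≤ q) (hb : 0 ≤ b) (hba : b ≤ a) :
    (a ^ q - b ^ q) * b ≤ q * a ^ q * (a - b) := by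
  rcases hb.eq_or_lt with rfl | hb
  · rw [mul_zero]
    have : 0 ≤ a ^ q := Real.rpow_nonneg hba q
    exact mul_nonneg (mul_nonneg hq this) (by linarith)
  have ha : 0 < a := hb.trans_le hba
  have haq : 0 < a ^ q := Real.rpow_pos_of_pos ha q
  have hlog : 1 - a / b ≤ Real.log (b / a) := by
    simpa using Real.one_sub_inv_le_log_of_pos (div_pos hb ha)
  have hexp : 1 + q * (1 - a / b) ≤ b ^ q / a ^ q := by
    rw [← Real.div_rpow hb.le ha.le, Real.rpow_def_of_pos (div_pos hb ha)]
    have := Real.add_one_le_exp (Real.log (b / a) * q)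
    nlinarith [mul_le_mul_of_nonneg_left hlog hq]
  rw [le_div_iff₀ haq] at hexp
  have h := mul_le_mul_of_nonneg_right hexp hb.le
  have : (1 + q * (1 - a / b)) * a ^ q * b = a ^ q * b - q * a ^ q * (a - b) := by
    field_simp
    ring
  linarith

/-- The Lipschitz bound for `X ↦ ‖X‖ ^ q • X`, in terms of the larger of the two norms. -/
theorem norm_rpow_smul_sub_le_of_norm_le {V : Type*} [SeminormedAddCommGroup V] [NormedSpace ℝ V]
    {q : ℝ} (hq : 0 ≤ q) {X Y : V} (hYX : ‖Y‖ ≤ ‖X‖) :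
    ‖‖X‖ ^ q • X - ‖Y‖ ^ q • Y‖ ≤ (q + 1) * ‖X‖ ^ q * ‖X - Y‖ := by
  have hX : 0 ≤ ‖X‖ ^ q := Real.rpow_nonneg (norm_nonneg X) q
  have hmono : ‖Y‖ ^ q ≤ ‖X‖ ^ q := Real.rpow_le_rpow (norm_nonneg Y) hYX hq
  calc ‖‖X‖ ^ q • X - ‖Y‖ ^ q • Y‖
      = ‖‖X‖ ^ q • (X - Y) + (‖X‖ ^ q - ‖Y‖ ^ q) • Y‖ := by
        congr 1
        module
    _ ≤ ‖X‖ ^ q * ‖X - Y‖ + (‖X‖ ^ q - ‖Y‖ ^ q) * ‖Y‖ := by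
        refine (norm_add_le _ _).trans_eq ?_
        rw [norm_smul, norm_smul, Real.norm_of_nonneg hX,
          Real.norm_of_nonneg (sub_nonneg.2 hmono)]
    _ ≤ ‖X‖ ^ q * ‖X - Y‖ + q * ‖X‖ ^ q * ‖X - Y‖ := by
        refine add_le_add le_rfl ?_
        exact (Real.rpow_sub_rpow_mul_le hq (norm_nonneg Y) hYX).trans
          (mul_le_mul_of_nonneg_left (norm_sub_norm_le X Y) (mul_nonneg hq hX))
    _ = (q + 1) * ‖X‖ ^ q * ‖X - Y‖ := by ring

/-- Lemma 2.1, inequality (2.5): for a real inner product space `V`, any real `q ≥ 0`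
and any `X Y : V`, one has `||X|^q X - |Y|^q Y| ≤ (q+1)(|X|^q + |Y|^q)|X - Y|`. -/
theorem lipschitz_inequality_rpow
    {V : Type*} [NormedAddCommGroup V] [InnerProductSpace ℝ V]
    (q : ℝ) (hq : 0 ≤ q) (X Y : V) :
    ‖‖X‖ ^ q • X - ‖Y‖ ^ q • Y‖ ≤ (q + 1) * (‖X‖ ^ q + ‖Y‖ ^ q) * ‖X - Y‖ := by
  have hX : 0 ≤ ‖X‖ ^ q := Real.rpow_nonneg (norm_nonneg X) q
  have hY : 0 ≤ ‖Y‖ ^ q := Real.rpow_nonneg (norm_nonneg Y) q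
  rcases le_total ‖Y‖ ‖X‖ with h | h
  · refine (norm_rpow_smul_sub_le_of_norm_le hq h).trans ?_
    gcongr
    exact le_add_of_nonneg_right hY
  · rw [norm_sub_rev, norm_sub_rev X Y]
    refine (norm_rpow_smul_sub_le_of_norm_le hq h).trans ?_
    gcongr
    exact le_add_of_nonneg_left hX
end

section
/- For all real numbers $r \ge 0$, $q \ge 0$ and $\theta \in [0, 2\pi]$, one has $1 + r^{q+2} - r(1 + r^{q})\cos\theta \ \ge\ \tfrac{1}{2}\,(1 + r^{q})\,(1 + r^{2} - 2 r \cos\theta)$. -/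
/-- Two-dimensional normalized form of the monotonicity inequality: for `r ≥ 0`,
`q ≥ 0` and `θ ∈ [0, 2π]`,
`1 + r^(q+2) - r(1+r^q)cos θ ≥ (1/2)(1+r^q)(1+r^2-2r cos θ)`. -/
theorem planar_monotonicity_inequality
    (r q θ : ℝ) (hr : 0 ≤ r) (hq : 0 ≤ q) (hθ : θ ∈ Set.Icc 0 (2 * Real.pi)) :
    (1 / 2) * (1 + r ^ q) * (1 + r ^ (2 : ℝ) - 2 * r * Real.cos θ) ≤
      1 + r ^ (q + 2) - r * (1 + r ^ q) * Real.cos θ := by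
  have hadd : r ^ (q + 2) = r ^ q * r ^ (2 : ℝ) :=
    Real.rpow_add_of_nonneg hr hq zero_le_two
  have hprod : 0 ≤ (r ^ q - 1) * (r ^ (2 : ℝ) - 1) := by
    rcases le_total r 1 with h | h
    · exact mul_nonneg_of_nonpos_of_nonpos
        (sub_nonpos.2 (Real.rpow_le_one hr h hq))
        (sub_nonpos.2 (Real.rpow_le_one hr h zero_le_two))
    · exact mul_nonneg (sub_nonneg.2 (Real.one_le_rpow h hq))
        (sub_nonneg.2 (Real.one_le_rpow h zero_le_two))
  rw [hadd]
  linarith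
end

section
/- Let $k, m \ge 1$, $p \ge 2$ a real number, let $S \subseteq \mathbb{R}^k$, and let $B$ assign to each $x \in S$ a continuous bilinear map $B(x) : \mathbb{R}^k \times \mathbb{R}^k \to \mathbb{R}^k$, with constants $C_0, L \ge 0$ such that $\|B(x)(Y,Z)\| \le C_0\|Y\|\|Z\|$ for all $x \in S$, $Y,Z \in \mathbb{R}^k$, and $\|B(y)(Y,Z) - B(z)(Y,Z)\| \le L\|y-z\|\|Y\|\|Z\|$ for all $y,z \in S$, $Y,Z \in \mathbb{R}^k$. Then there is a constant $C$ depending only on $p$, $C_0$ and $L$ such that for all $y, z \in S$ and all $m$-tuples $X = (X_1, \dots, X_m)$, $W = (W_1, \dots, W_m)$ of vectors of $\mathbb{R}^k$, setting $\|X\| = \left(\sum_{i=1}^m \|X_i\|^2\right)^{1/2}$ and likewise for $\|W\|$: $\left\| \sum_{i=1}^{m} \left( \|X\|^{p-2} B(y)(X_i, X_i) - \|W\|^{p-2} B(z)(W_i, W_i) \right) \right\| \le C\left( \|X\|^{p} + \|W\|^{p} \right)\|y - z\| + C\left( \|X\|^{p-1} + \|W\|^{p-1} \right)\left( \sum_{i=1}^m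 \|X_i - W_i\|^2 \right)^{1/2}$. -/
open scoped BigOperators

/-- The mean value bound for `t ↦ t ^ p` on the nonnegative half-line, one-sided form. -/
theorem rpow_sub_rpow_le_mul_sub {p a b : ℝ} (hp : 1 ≤ p) (ha : 0 ≤ a) (hb : 0 ≤ b) :
    a ^ p - b ^ p ≤ p * a ^ (p - 1) * (a - b) := by
  rcases ha.eq_or_lt with rfl | ha
  · rcases hp.eq_or_lt with rfl | hp
    · simp
    · rw [Real.zero_rpow (by linarith), Real.zero_rpow (by linarith)]
      linarith [Real.rpow_nonneg hb p]
  · have h := one_add_mul_self_le_rpow_one_add (s := b / a - 1)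
      (by linarith [div_nonneg hb ha.le]) hp
    rw [add_sub_cancel, Real.div_rpow hb ha.le, le_div_iff₀ (Real.rpow_pos_of_pos ha p)] at h
    have e : a ^ p = a ^ (p - 1) * a := by
      rw [← Real.rpow_add_one ha.ne', sub_add_cancel]
    have e' : p * (b / a - 1) * a ^ p = p * a ^ (p - 1) * (b - a) := by
      rw [e]; field_simp
    nlinarith

theorem abs_rpow_sub_rpow_le {p a b : ℝ} (hp : 1 ≤ p) (ha : 0 ≤ a) (hb : 0 ≤ b) :
    |a ^ p - b ^ p| ≤ p * (a ^ (p - 1) + b ^ (p - 1)) * |a - b| := by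
  have main : ∀ {a b : ℝ}, 0 ≤ a → 0 ≤ b →
      a ^ p - b ^ p ≤ p * (a ^ (p - 1) + b ^ (p - 1)) * |a - b| := by
    intro a b ha hb
    have hA := Real.rpow_nonneg ha (p - 1)
    have hB := Real.rpow_nonneg hb (p - 1)
    calc a ^ p - b ^ p ≤ p * a ^ (p - 1) * (a - b) := rpow_sub_rpow_le_mul_sub hp ha hb
      _ ≤ p * (a ^ (p - 1) + b ^ (p - 1)) * |a - b| := by
        refine (mul_le_mul_of_nonneg_left (le_abs_self _) (by positivity)).trans ?_
        gcongr
        exact le_add_of_nonneg_right hB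
  refine abs_sub_le_iff.2 ⟨main ha hb, ?_⟩
  rw [add_comm (a ^ (p - 1)), abs_sub_comm]
  exact main hb ha

theorem rpow_sub_two_mul_sq {p a : ℝ} (hp : 2 ≤ p) (ha : 0 ≤ a) :
    a ^ (p - 2) * a ^ 2 = a ^ p := by
  rw [← Real.rpow_natCast a 2, ← Real.rpow_add_of_nonneg ha (by linarith) (by norm_num)]
  norm_num

theorem abs_rpow_sub_two_sub_mul_sq_le {p a b : ℝ} (hp : 2 ≤ p) (ha : 0 ≤ a) (hb : 0 ≤ b) :
    |a ^ (p - 2) - b ^ (p - 2)| * b ^ 2 ≤ |a ^ p - b ^ p| := by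
  have hq : 0 ≤ p - 2 := by linarith
  have hA := Real.rpow_nonneg ha (p - 2)
  rw [← rpow_sub_two_mul_sq hp ha, ← rpow_sub_two_mul_sq hp hb]
  rcases le_total a b with h | h
  · have h1 := Real.rpow_le_rpow ha h hq
    have h2 : a ^ 2 ≤ b ^ 2 := by gcongr
    rw [abs_of_nonpos (by linarith), abs_of_nonpos (by nlinarith [sq_nonneg b])]
    nlinarith
  · have h1 := Real.rpow_le_rpow hb h hq
    have h2 : b ^ 2 ≤ a ^ 2 := by gcongr
    rw [abs_of_nonneg (by linarith), abs_of_nonneg (by nlinarith [sq_nonneg b])]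
    nlinarith

theorem rpow_sub_two_mul_add_le {p a b : ℝ} (hp : 2 ≤ p) (ha : 0 ≤ a) (hb : 0 ≤ b) :
    a ^ (p - 2) * (a + b) ≤ 2 * (a ^ (p - 1) + b ^ (p - 1)) := by
  have key : ∀ {t : ℝ}, 0 ≤ t → t ^ (p - 2) * t = t ^ (p - 1) := by
    intro t ht
    rw [← Real.rpow_add_one' ht (by linarith)]
    ring_nf
  have hA := Real.rpow_nonneg ha (p - 2)
  have hA' := Real.rpow_nonneg ha (p - 1)
  have hB' := Real.rpow_nonneg hb (p - 1)
  rcases le_total a b with h | h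
  · have h1 := Real.rpow_le_rpow ha h (by linarith : 0 ≤ p - 2)
    have h2 := mul_le_mul_of_nonneg_right h1 hb
    rw [key hb] at h2
    linarith [key ha]
  · have h2 := mul_le_mul_of_nonneg_left h hA
    linarith [key ha]

section Tuples

variable {ι E F : Type*} [Fintype ι] [NormedAddCommGroup E] [NormedAddCommGroup F]

theorem abs_sqrt_sum_sq_norm_sub_le (X W : ι → E) :
    |√(∑ i, ‖X i‖ ^ 2) - √(∑ i, ‖W i‖ ^ 2)| ≤ √(∑ i, ‖X i - W i‖ ^ 2) := by
  simpa [PiLp.norm_eq_of_L2] using abs_norm_sub_norm_le (WithLp.toLp 2 X) (WithLp.toLp 2 W)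

theorem norm_sum_le_mul_sqrt_mul_sqrt {c : ℝ} (hc : 0 ≤ c) (X W : ι → E) (f : ι → F)
    (hf : ∀ i, ‖f i‖ ≤ c * ‖X i‖ * ‖W i‖) :
    ‖∑ i, f i‖ ≤ c * √(∑ i, ‖X i‖ ^ 2) * √(∑ i, ‖W i‖ ^ 2) := by
  calc ‖∑ i, f i‖ ≤ ∑ i, c * ‖X i‖ * ‖W i‖ := norm_sum_le_of_le _ fun i _ => hf i
    _ = c * ∑ i, ‖X i‖ * ‖W i‖ := by simp only [Finset.mul_sum, mul_assoc]
    _ ≤ c * (√(∑ i, ‖X i‖ ^ 2) * √(∑ i, ‖W i‖ ^ 2)) := by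
      gcongr
      exact Real.sum_mul_le_sqrt_mul_sqrt _ _ _
    _ = _ := by ring

variable [NormedSpace ℝ E] [NormedSpace ℝ F]

theorem norm_sum_bilinear_diag_sub_le {c : ℝ} (hc : 0 ≤ c) (b : E →L[ℝ] E →L[ℝ] F)
    (hb : ∀ Y Z, ‖b Y Z‖ ≤ c * ‖Y‖ * ‖Z‖) (X W : ι → E) :
    ‖∑ i, (b (X i) (X i) - b (W i) (W i))‖ ≤
      c * (√(∑ i, ‖X i‖ ^ 2) + √(∑ i, ‖W i‖ ^ 2)) * √(∑ i, ‖X i - W i‖ ^ 2) := by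
  have e : ∑ i, (b (X i) (X i) - b (W i) (W i)) =
      ∑ i, b (X i) (X i - W i) + ∑ i, b (X i - W i) (W i) := by
    rw [← Finset.sum_add_distrib]
    refine Finset.sum_congr rfl fun i _ => ?_
    simp
  have h₁ := norm_sum_le_mul_sqrt_mul_sqrt hc X (fun i => X i - W i) _ fun i => hb _ _
  have h₂ := norm_sum_le_mul_sqrt_mul_sqrt hc (fun i => X i - W i) W _ fun i => hb _ _
  rw [e]
  linarith [norm_add_le (∑ i, b (X i) (X i - W i)) (∑ i, b (X i - W i) (W i))]

end Tuples

/-- Abstract form of inequality (2.16): for a bounded Lipschitz field `B` of continuous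
bilinear maps on `ℝᵏ`, there is a constant `C = C(p, C₀, L)` such that for `m`-tuples
`X, W` of vectors of `ℝᵏ` (with `‖X‖ = (∑ᵢ ‖Xᵢ‖²)^{1/2}`):
`‖∑ᵢ (‖X‖^{p-2} B(y)(Xᵢ,Xᵢ) - ‖W‖^{p-2} B(z)(Wᵢ,Wᵢ))‖
  ≤ C(‖X‖^p + ‖W‖^p)‖y-z‖ + C(‖X‖^{p-1} + ‖W‖^{p-1})(∑ᵢ ‖Xᵢ-Wᵢ‖²)^{1/2}`. -/
theorem bilinear_field_p_energy_estimate
    (p : ℝ) (hp : 2 ≤ p) (C₀ L : ℝ) (hC₀ : 0 ≤ C₀) (hL : 0 ≤ L) :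
    ∃ C : ℝ, ∀ (k m : ℕ), 1 ≤ k → 1 ≤ m →
      ∀ (S : Set (EuclideanSpace ℝ (Fin k)))
        (B : EuclideanSpace ℝ (Fin k) →
          EuclideanSpace ℝ (Fin k) →L[ℝ] EuclideanSpace ℝ (Fin k) →L[ℝ]
            EuclideanSpace ℝ (Fin k)),
        (∀ x ∈ S, ∀ Y Z, ‖B x Y Z‖ ≤ C₀ * ‖Y‖ * ‖Z‖) →
        (∀ y ∈ S, ∀ z ∈ S, ∀ Y Z,
          ‖B y Y Z - B z Y Z‖ ≤ L * ‖y - z‖ * ‖Y‖ * ‖Z‖) →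
        ∀ y ∈ S, ∀ z ∈ S, ∀ X W : Fin m → EuclideanSpace ℝ (Fin k),
          ‖∑ i, ((Real.sqrt (∑ j, ‖X j‖ ^ 2)) ^ (p - 2) • B y (X i) (X i) -
              (Real.sqrt (∑ j, ‖W j‖ ^ 2)) ^ (p - 2) • B z (W i) (W i))‖ ≤
            C * ((Real.sqrt (∑ j, ‖X j‖ ^ 2)) ^ p +
                (Real.sqrt (∑ j, ‖W j‖ ^ 2)) ^ p) * ‖y - z‖ +
            C * ((Real.sqrt (∑ j, ‖X j‖ ^ 2)) ^ (p - 1) +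
                (Real.sqrt (∑ j, ‖W j‖ ^ 2)) ^ (p - 1)) *
              Real.sqrt (∑ i, ‖X i - W i‖ ^ 2) := by
  refine ⟨L + (p + 2) * C₀, ?_⟩
  intro k m _ _ S B hB hLip y hy z hz X W
  have hd := abs_sqrt_sum_sq_norm_sub_le X W
  have hdiff := norm_sum_le_mul_sqrt_mul_sqrt (mul_nonneg hL (norm_nonneg (y - z))) X X
    (fun i => B y (X i) (X i) - B z (X i) (X i)) fun i => hLip y hy z hz _ _
  have hdiag := norm_sum_bilinear_diag_sub_le hC₀ (B z) (hB z hz) X W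
  have hW := norm_sum_le_mul_sqrt_mul_sqrt hC₀ W W
    (fun i => B z (W i) (W i)) fun i => hB z hz _ _
  set a := Real.sqrt (∑ j, ‖X j‖ ^ 2)
  set b := Real.sqrt (∑ j, ‖W j‖ ^ 2)
  set d := Real.sqrt (∑ i, ‖X i - W i‖ ^ 2)
  have ha : 0 ≤ a := Real.sqrt_nonneg _
  have hb : 0 ≤ b := Real.sqrt_nonneg _
  have hd0 : 0 ≤ d := Real.sqrt_nonneg _
  have hA := Real.rpow_nonneg ha (p - 2)
  have e : ∑ i, (a ^ (p - 2) • B y (X i) (X i) - b ^ (p - 2) • B z (W i) (W i)) =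
      a ^ (p - 2) • ∑ i, (B y (X i) (X i) - B z (X i) (X i)) +
      a ^ (p - 2) • ∑ i, (B z (X i) (X i) - B z (W i) (W i)) +
      (a ^ (p - 2) - b ^ (p - 2)) • ∑ i, B z (W i) (W i) := by
    simp only [Finset.sum_sub_distrib, ← Finset.smul_sum]
    module
  have h₁ : ‖a ^ (p - 2) • ∑ i, (B y (X i) (X i) - B z (X i) (X i))‖ ≤
      L * a ^ p * ‖y - z‖ := by
    rw [norm_smul, Real.norm_of_nonneg hA, ← rpow_sub_two_mul_sq hp ha]
    linarith [mul_le_mul_of_nonneg_left hdiff hA]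
  have h₂ : ‖a ^ (p - 2) • ∑ i, (B z (X i) (X i) - B z (W i) (W i))‖ ≤
      2 * C₀ * (a ^ (p - 1) + b ^ (p - 1)) * d := by
    rw [norm_smul, Real.norm_of_nonneg hA]
    linarith [mul_le_mul_of_nonneg_left hdiag hA,
      mul_le_mul_of_nonneg_left (rpow_sub_two_mul_add_le hp ha hb) (mul_nonneg hC₀ hd0)]
  have hA₁ := Real.rpow_nonneg ha (p - 1)
  have hB₁ := Real.rpow_nonneg hb (p - 1)
  have h₃ : ‖(a ^ (p - 2) - b ^ (p - 2)) • ∑ i, B z (W i) (W i)‖ ≤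
      p * C₀ * (a ^ (p - 1) + b ^ (p - 1)) * d := by
    rw [norm_smul, Real.norm_eq_abs]
    calc |a ^ (p - 2) - b ^ (p - 2)| * ‖∑ i, B z (W i) (W i)‖
        ≤ |a ^ (p - 2) - b ^ (p - 2)| * (C₀ * b * b) := by gcongr
      _ = C₀ * (|a ^ (p - 2) - b ^ (p - 2)| * b ^ 2) := by ring
      _ ≤ C₀ * (p * (a ^ (p - 1) + b ^ (p - 1)) * |a - b|) := by
        refine mul_le_mul_of_nonneg_left ?_ hC₀
        exact (abs_rpow_sub_two_sub_mul_sq_le hp ha hb).trans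
          (abs_rpow_sub_rpow_le (by linarith) ha hb)
      _ ≤ C₀ * (p * (a ^ (p - 1) + b ^ (p - 1)) * d) := by gcongr
      _ = _ := by ring
  have h₄ : L * a ^ p * ‖y - z‖ ≤ (L + (p + 2) * C₀) * (a ^ p + b ^ p) * ‖y - z‖ := by
    have hAp := Real.rpow_nonneg ha p
    have hBp := Real.rpow_nonneg hb p
    gcongr
    · exact le_add_of_nonneg_right (by positivity)
    · exact le_add_of_nonneg_right hBp
  have h₅ : 0 ≤ L * (a ^ (p - 1) + b ^ (p - 1)) * d := by positivity
  rw [e]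
  refine (norm_add₃_le).trans ?_
  linarith
end
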